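/- arXiv:2310.05833 — 3 statements merged into one kernel-verified Lean document; each statement's English description precedes it below -/
import Mathlib

section
/- Let Q be a probability measure on 𝒴, Y : Ω → 𝒴 a random element with law Q, and let P̂₁, …, P̂ₙ (n ≥ 2) be random probability measures on 𝒴 on the same probability space, jointly independent of Y, identically distributed, and with a common value of Cov_k(P̂ᵢ, P̂ⱼ) for all i ≠ j. Then for the mixture ensemble P̂⁽ⁿ⁾ := (1/n) Σᵢ P̂ᵢ: E[S_k(P̂⁽ⁿ⁾, Y)] = −⟨Q|k|Q⟩ + (⟨E[P̂₁]|k|E[P̂₁]⟩ − 2⟨E[P̂₁]|k|Q⟩ + ⟨Q|k|Q⟩) + (1/n) Var_k(P̂₁) + ((n−1)/n) Cov_k(P̂₁, P̂₂); that is, noise plus bias ‖E[P̂₁] − Q‖_k² plus (1/n)·variance plus ((n−1)/n)·covariance. -/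
open MeasureTheory ProbabilityTheory

noncomputable section

/-- The kernel bilinear form `⟨P|k|Q⟩ = ∫∫ k(x,y) dP(x) dQ(y)`. -/
def kerInner {Y : Type*} [MeasurableSpace Y] (k : Y → Y → ℝ) (P Q : Measure Y) : ℝ :=
  ∫ x, ∫ y, k x y ∂Q ∂P

/-- The kernel score `S_k(P, y) = ‖P‖_k² − 2 ∫ k(x, y) dP(x)`. -/
def kScore {Y : Type*} [MeasurableSpace Y] (k : Y → Y → ℝ) (P : Measure Y) (y : Y) : ℝ :=
  kerInner k P P - 2 * ∫ x, k x y ∂P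

/-- The distributional variance `Var_k(P̂) = E[⟨P̂|k|P̂⟩] − ⟨E[P̂]|k|E[P̂]⟩`. -/
def distVar {Y Ω : Type*} [MeasurableSpace Y] [MeasurableSpace Ω] (k : Y → Y → ℝ)
    (Pr : Measure Ω) (Phat : Ω → Measure Y) : ℝ :=
  (∫ ω, kerInner k (Phat ω) (Phat ω) ∂Pr) - kerInner k (Pr.bind Phat) (Pr.bind Phat)

/-- The distributional covariance `Cov_k(P̂, Q̂) = E[⟨P̂|k|Q̂⟩] − ⟨E[P̂]|k|E[Q̂]⟩`. -/
def distCov {Y Ω : Type*} [MeasurableSpace Y] [MeasurableSpace Ω] (k : Y → Y → ℝ)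
    (Pr : Measure Ω) (Phat Qhat : Ω → Measure Y) : ℝ :=
  (∫ ω, kerInner k (Phat ω) (Qhat ω) ∂Pr) - kerInner k (Pr.bind Phat) (Pr.bind Qhat)

section KernelMeanEmbedding

variable {Y Ω : Type*} [MeasurableSpace Y] [MeasurableSpace Ω] {k : Y → Y → ℝ}

lemma integrable_kernel_of_bounded (hk_meas : Measurable fun p : Y × Y => k p.1 p.2)
    (hk_bdd : ∃ K, ∀ x y, |k x y| ≤ K) (μ : Measure (Y × Y)) [IsFiniteMeasure μ] :
    Integrable (fun p : Y × Y => k p.1 p.2) μ := by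
  obtain ⟨K, hK⟩ := hk_bdd
  exact Integrable.of_bound hk_meas.aestronglyMeasurable K (ae_of_all _ fun p => hK p.1 p.2)

lemma kerInner_eq_integral_prod (hk_meas : Measurable fun p : Y × Y => k p.1 p.2)
    (hk_bdd : ∃ K, ∀ x y, |k x y| ≤ K) (P Q : Measure Y) [IsFiniteMeasure P]
    [IsFiniteMeasure Q] :
    kerInner k P Q = ∫ p, k p.1 p.2 ∂(P.prod Q) :=
  (integral_prod _ (integrable_kernel_of_bounded hk_meas hk_bdd _)).symm

lemma kerInner_dirac (hk_meas : Measurable fun p : Y × Y => k p.1 p.2) (P : Measure Y) (y : Y) :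
    kerInner k P (Measure.dirac y) = ∫ x, k x y ∂P := by
  refine integral_congr_ae (ae_of_all _ fun x => ?_)
  exact integral_dirac' _ _ (hk_meas.comp measurable_prodMk_left).stronglyMeasurable

lemma integrable_kernel_left (hk_meas : Measurable fun p : Y × Y => k p.1 p.2)
    (hk_bdd : ∃ K, ∀ x y, |k x y| ≤ K) (y : Y) (P : Measure Y) [IsFiniteMeasure P] :
    Integrable (fun x => k x y) P := by
  obtain ⟨K, hK⟩ := hk_bdd
  exact Integrable.of_bound (hk_meas.comp measurable_prodMk_right).aestronglyMeasurable K
    (ae_of_all _ fun x => hK x y)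

lemma kerInner_mixture (hk_meas : Measurable fun p : Y × Y => k p.1 p.2)
    (hk_bdd : ∃ K, ∀ x y, |k x y| ≤ K) {n : ℕ} (P : Fin n → Measure Y)
    [∀ i, IsFiniteMeasure (P i)] :
    kerInner k ((n : ENNReal)⁻¹ • ∑ i, P i) ((n : ENNReal)⁻¹ • ∑ i, P i)
      = (n : ℝ)⁻¹ * ((n : ℝ)⁻¹ * ∑ i, ∑ j, kerInner k (P i) (P j)) := by
  have hr (x : Y) (j : Fin n) : Integrable (fun y => k x y) (P j) := by
    obtain ⟨K, hK⟩ := hk_bdd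
    exact Integrable.of_bound (hk_meas.comp measurable_prodMk_left).aestronglyMeasurable K
      (ae_of_all _ fun y => hK x y)
  have hl (i j : Fin n) : Integrable (fun x => ∫ y, k x y ∂(P j)) (P i) :=
    (integrable_kernel_of_bounded hk_meas hk_bdd ((P i).prod (P j))).integral_prod_left
  unfold kerInner
  simp only [integral_smul_measure, ENNReal.toReal_inv, ENNReal.toReal_natCast, smul_eq_mul]
  simp only [integral_finsetSum_measure fun j _ => hr _ j, integral_const_mul]
  rw [integral_finsetSum_measure fun i _ => integrable_finsetSum _ fun j _ => hl i j]
  simp only [integral_finsetSum _ fun j _ => hl _ j]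

lemma integral_mixture (hk_meas : Measurable fun p : Y × Y => k p.1 p.2)
    (hk_bdd : ∃ K, ∀ x y, |k x y| ≤ K) {n : ℕ} (P : Fin n → Measure Y)
    [∀ i, IsFiniteMeasure (P i)] (y : Y) :
    ∫ x, k x y ∂((n : ENNReal)⁻¹ • ∑ i, P i) = (n : ℝ)⁻¹ * ∑ i, kerInner k (P i) (.dirac y) := by
  rw [integral_smul_measure,
    integral_finsetSum_measure fun i _ => integrable_kernel_left hk_meas hk_bdd y (P i)]
  simp [kerInner_dirac hk_meas]

lemma comp_prod_apply_prod {Pr : Measure Ω} (κ η : Kernel Ω Y) [IsMarkovKernel κ] [IsMarkovKernel η]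
    {s t : Set Y} (hs : MeasurableSet s) (ht : MeasurableSet t) :
    ((κ ×ₖ η) ∘ₘ Pr) (s ×ˢ t) = ∫⁻ ω, κ ω s * η ω t ∂Pr := by
  simp [Measure.bind_apply (hs.prod ht) (Kernel.aemeasurable _), Kernel.prod_apply]

variable {Pr : Measure Ω} [IsProbabilityMeasure Pr]

lemma integrable_kerInner (hk_meas : Measurable fun p : Y × Y => k p.1 p.2)
    (hk_bdd : ∃ K, ∀ x y, |k x y| ≤ K) (κ η : Kernel Ω Y) [IsMarkovKernel κ]
    [IsMarkovKernel η] :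
    Integrable (fun ω => kerInner k (κ ω) (η ω)) Pr := by
  have h : (fun ω => kerInner k (κ ω) (η ω)) = fun ω => ∫ p, k p.1 p.2 ∂((κ ×ₖ η) ω) := by
    ext ω
    rw [Kernel.prod_apply, kerInner_eq_integral_prod hk_meas hk_bdd]
  have hint := integrable_kernel_of_bounded hk_meas hk_bdd ((κ ×ₖ η) ∘ₘ Pr)
  rw [Measure.comp_eq_comp_const_apply] at hint
  rw [h]
  simpa using hint.integral_comp

lemma integral_kerInner (hk_meas : Measurable fun p : Y × Y => k p.1 p.2)
    (hk_bdd : ∃ K, ∀ x y, |k x y| ≤ K) (κ η : Kernel Ω Y) [IsMarkovKernel κ]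
    [IsMarkovKernel η] :
    ∫ ω, kerInner k (κ ω) (η ω) ∂Pr = ∫ p, k p.1 p.2 ∂((κ ×ₖ η) ∘ₘ Pr) := by
  have hint := integrable_kernel_of_bounded hk_meas hk_bdd ((κ ×ₖ η) ∘ₘ Pr)
  rw [Measure.comp_eq_comp_const_apply] at hint ⊢
  rw [Kernel.integral_comp hint]
  simp [Kernel.prod_apply, kerInner_eq_integral_prod hk_meas hk_bdd]

/-- The mean of the norm of a random probability measure depends only on its law. -/
lemma integral_kerInner_self_congr (hk_meas : Measurable fun p : Y × Y => k p.1 p.2)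
    (hk_bdd : ∃ K, ∀ x y, |k x y| ≤ K) (κ η : Kernel Ω Y) [IsMarkovKernel κ]
    [IsMarkovKernel η] (h : Pr.map κ = Pr.map η) :
    ∫ ω, kerInner k (κ ω) (κ ω) ∂Pr = ∫ ω, kerInner k (η ω) (η ω) ∂Pr := by
  rw [integral_kerInner hk_meas hk_bdd, integral_kerInner hk_meas hk_bdd]
  congr 1
  refine Measure.ext_prod fun {s t} hs ht => ?_
  have hm : Measurable fun μ : Measure Y => μ s * μ t :=
    (Measure.measurable_coe hs).mul (Measure.measurable_coe ht)
  rw [comp_prod_apply_prod κ κ hs ht, comp_prod_apply_prod η η hs ht,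
    ← lintegral_map hm κ.measurable, h, lintegral_map hm η.measurable]

/-- Independence factorizes the expected inner product of a random probability measure with
the Dirac mass at a random point. -/
lemma integral_kerInner_dirac_of_indepFun (hk_meas : Measurable fun p : Y × Y => k p.1 p.2)
    (hk_bdd : ∃ K, ∀ x y, |k x y| ≤ K) (κ : Kernel Ω Y) [IsMarkovKernel κ] {Z : Ω → Y}
    (hZ : Measurable Z) (h : IndepFun κ Z Pr) :
    ∫ ω, kerInner k (κ ω) (.dirac (Z ω)) ∂Pr = kerInner k (κ ∘ₘ Pr) (Pr.map Z) := by
  have : IsProbabilityMeasure (Pr.map Z) := Measure.isProbabilityMeasure_map hZ.aemeasurable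
  have hI := integral_kerInner (Pr := Pr) hk_meas hk_bdd κ (Kernel.deterministic Z hZ)
  simp only [Kernel.deterministic_apply] at hI
  rw [hI, kerInner_eq_integral_prod hk_meas hk_bdd]
  congr 1
  refine (Measure.prod_eq fun s t hs ht => ?_).symm
  have hκ : Measurable fun ω => κ ω s := κ.measurable_coe hs
  have hd : Measurable (t.indicator (1 : Y → ENNReal)) := measurable_one.indicator ht
  rw [comp_prod_apply_prod _ _ hs ht, Measure.bind_apply hs κ.aemeasurable,
    Measure.map_apply hZ ht]
  simp only [Kernel.deterministic_apply, Measure.dirac_apply' _ ht]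
  have hind := lintegral_mul_eq_lintegral_mul_lintegral_of_indepFun hκ (hd.comp hZ)
    (h.comp (Measure.measurable_coe hs) hd)
  simp only [Pi.mul_apply, Function.comp_apply] at hind
  rw [hind, ← lintegral_map hd hZ, lintegral_indicator_one ht, Measure.map_apply hZ ht]

end KernelMeanEmbedding

/-- Bias-variance-covariance decomposition of the expected kernel score of a mixture
ensemble of identically distributed random probability measures:
`E[S_k(P̂⁽ⁿ⁾, Y)] = −‖Q‖_k² + ‖E[P̂₁] − Q‖_k² + (1/n) Var_k(P̂₁) + ((n−1)/n) Cov_k(P̂₁, P̂₂)`. -/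
theorem kernel_score_bias_variance_covariance_decomposition
    {Y Ω : Type*} [MeasurableSpace Y] [MeasurableSpace Ω]
    (Pr : Measure Ω) [IsProbabilityMeasure Pr]
    (k : Y → Y → ℝ)
    (hk_meas : Measurable fun p : Y × Y => k p.1 p.2)
    (hk_symm : ∀ x y, k x y = k y x)
    (hk_bdd : ∃ K, ∀ x y, |k x y| ≤ K)
    (hk_psd : ∀ (N : ℕ) (x : Fin N → Y) (a : Fin N → ℝ),
      0 ≤ ∑ i, ∑ j, a i * k (x i) (x j) * a j)
    (Q : Measure Y) [IsProbabilityMeasure Q]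
    (Yr : Ω → Y) (hYr : Measurable Yr) (hYlaw : Pr.map Yr = Q)
    (n : ℕ) (hn : 2 ≤ n)
    (Phat : Fin n → Ω → Measure Y)
    (hPmeas : ∀ i, Measurable (Phat i))
    (hPprob : ∀ i ω, IsProbabilityMeasure (Phat i ω))
    (hindep : IndepFun (fun ω i => Phat i ω) Yr Pr)
    (hid : ∀ i j, Pr.map (Phat i) = Pr.map (Phat j))
    (hcov : ∀ i j i' j', i ≠ j → i' ≠ j' →
      distCov k Pr (Phat i) (Phat j) = distCov k Pr (Phat i') (Phat j')) :
    ∫ ω, kScore k ((n : ENNReal)⁻¹ • ∑ i, Phat i ω) (Yr ω) ∂Pr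
      = -(kerInner k Q Q)
        + (kerInner k (Pr.bind (Phat ⟨0, by omega⟩)) (Pr.bind (Phat ⟨0, by omega⟩))
            - 2 * kerInner k (Pr.bind (Phat ⟨0, by omega⟩)) Q + kerInner k Q Q)
        + (1 / (n : ℝ)) * distVar k Pr (Phat ⟨0, by omega⟩)
        + (((n : ℝ) - 1) / (n : ℝ)) *
            distCov k Pr (Phat ⟨0, by omega⟩) (Phat ⟨1, by omega⟩) := by
  have hn0 : (n : ℝ) ≠ 0 := by positivity
  set i₀ : Fin n := ⟨0, by omega⟩ with hi₀
  set i₁ : Fin n := ⟨1, by omega⟩ with hi₁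
  have h01 : i₀ ≠ i₁ := by simp [hi₀, hi₁]
  let κ : Fin n → Kernel Ω Y := fun i => ⟨Phat i, hPmeas i⟩
  have hκ (i : Fin n) : IsMarkovKernel (κ i) := ⟨hPprob i⟩
  let δ : Kernel Ω Y := Kernel.deterministic Yr hYr
  have hδ (ω : Ω) : δ ω = Measure.dirac (Yr ω) := Kernel.deterministic_apply hYr ω
  have hmean (i : Fin n) : Pr.bind (Phat i) = Pr.bind (Phat i₀) :=
    congrArg Measure.join (hid i i₀)
  have hPP (i j : Fin n) : Integrable (fun ω => kerInner k (Phat i ω) (Phat j ω)) Pr :=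
    integrable_kerInner hk_meas hk_bdd (κ i) (κ j)
  have hPY (i : Fin n) : Integrable (fun ω => kerInner k (Phat i ω) (.dirac (Yr ω))) Pr := by
    simp only [← hδ]
    exact integrable_kerInner hk_meas hk_bdd (κ i) δ
  have hcross (i : Fin n) :
      ∫ ω, kerInner k (Phat i ω) (.dirac (Yr ω)) ∂Pr = kerInner k (Pr.bind (Phat i₀)) Q := by
    rw [← hmean i, ← hYlaw]
    exact integral_kerInner_dirac_of_indepFun hk_meas hk_bdd (κ i) hYr
      (hindep.comp (measurable_pi_apply i) measurable_id)
  set m := kerInner k (Pr.bind (Phat i₀)) (Pr.bind (Phat i₀)) with hm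
  have hpair (i j : Fin n) : ∫ ω, kerInner k (Phat i ω) (Phat j ω) ∂Pr
      = (if i = j then distVar k Pr (Phat i₀) - distCov k Pr (Phat i₀) (Phat i₁) else 0)
        + (distCov k Pr (Phat i₀) (Phat i₁) + m) := by
    split_ifs with hij
    · subst hij
      have := integral_kerInner_self_congr hk_meas hk_bdd (κ i) (κ i₀) (hid i i₀)
      simp only [distVar]
      linarith! [this]
    · rw [← hcov i j i₀ i₁ hij h01, distCov, hmean i, hmean j]
      ring
  have hscore (ω : Ω) : kScore k ((n : ENNReal)⁻¹ • ∑ i, Phat i ω) (Yr ω)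
      = (n : ℝ)⁻¹ * ((n : ℝ)⁻¹ * ∑ i, ∑ j, kerInner k (Phat i ω) (Phat j ω))
        - 2 * ((n : ℝ)⁻¹ * ∑ i, kerInner k (Phat i ω) (.dirac (Yr ω))) := by
    have (i : Fin n) : IsFiniteMeasure (Phat i ω) := inferInstance
    rw [kScore, kerInner_mixture hk_meas hk_bdd, integral_mixture hk_meas hk_bdd]
  have hPPsum (i : Fin n) :
      Integrable (fun ω => ∑ j, kerInner k (Phat i ω) (Phat j ω)) Pr :=
    integrable_finsetSum _ fun j _ => hPP i j
  simp only [hscore]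
  rw [integral_sub
      (((integrable_finsetSum _ fun i _ => hPPsum i).const_mul _).const_mul _)
      (((integrable_finsetSum _ fun i _ => hPY i).const_mul _).const_mul _)]
  simp only [integral_const_mul]
  rw [integral_finsetSum _ fun i _ => hPPsum i, integral_finsetSum _ fun i _ => hPY i]
  simp only [integral_finsetSum _ fun j _ => hPP _ j, hpair, hcross, Finset.sum_add_distrib,
    Finset.sum_ite_eq, Finset.mem_univ, if_true, Finset.sum_const, Finset.card_univ,
    Fintype.card_fin, nsmul_eq_mul]
  field_simp
  ring
end
end

section
/- Suppose |k(x, y)| ≤ K for all x, y ∈ 𝒴. Then there exists a constant C ≥ 0 depending only on K such that for all n ≥ 2 and m ≥ 2, the variance of the distributional variance estimator under the two-stage sampling law satisfies Var_{μ_{n,m}}(V̂ar_k^{(n,m)}) ≤ (C/n) (1 + 1/m), where Var_{μ_{n,m}}(f) := ∫ f² dμ_{n,m} − (∫ f dμ_{n,m})². -/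
open MeasureTheory ProbabilityTheory

noncomputable section

/-- The σ-algebra on the space of probability measures induced from the σ-algebra on
`Measure Y` generated by the evaluation maps. -/
instance {Y : Type*} [MeasurableSpace Y] : MeasurableSpace (ProbabilityMeasure Y) :=
  MeasurableSpace.comap (fun P => (P : Measure Y)) inferInstance

/-- The two-stage sampling law `μ_{n,m}` on `Fin n → Fin m → Y`: sample
`P₁, …, Pₙ` i.i.d. from `ν`, then conditionally on `Pᵢ` sample `X_{i1}, …, X_{im}`
i.i.d. from `Pᵢ`, independently across `i`. -/
def twoStage {Y : Type*} [MeasurableSpace Y] (ν : Measure (ProbabilityMeasure Y))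
    (n m : ℕ) : Measure (Fin n → Fin m → Y) :=
  (Measure.pi fun _ : Fin n => ν).bind
    (fun Ps => Measure.pi fun i : Fin n => Measure.pi fun _ : Fin m => (Ps i : Measure Y))

/-- The distributional variance estimator
`V̂ar_k^{(n,m)}(X) = (1/(n m (m−1))) Σᵢ Σ_{j≠t} k(X_{ij}, X_{it})
  − (1/(n (n−1) m²)) Σ_{i≠s} Σ_{j,t} k(X_{ij}, X_{st})`. -/
def varEst {Y : Type*} (k : Y → Y → ℝ) (n m : ℕ) (X : Fin n → Fin m → Y) : ℝ :=
  (1 / ((n : ℝ) * (m : ℝ) * ((m : ℝ) - 1))) *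
      ∑ i, ∑ j, ∑ t ∈ Finset.univ.erase j, k (X i j) (X i t)
  - (1 / ((n : ℝ) * ((n : ℝ) - 1) * (m : ℝ) ^ 2)) *
      ∑ i, ∑ s ∈ Finset.univ.erase i, ∑ j, ∑ t, k (X i j) (X s t)

section TwoStage

variable {Y : Type*} [MeasurableSpace Y]

/-- The law of an i.i.d. sample of size `m` depends measurably on the sampling distribution. -/
lemma measurable_pi_probabilityMeasure (m : ℕ) :
    Measurable fun P : ProbabilityMeasure Y => Measure.pi fun _ : Fin m => (P : Measure Y) := by
  refine Measurable.measure_of_isPiSystem_of_isProbabilityMeasure generateFrom_pi.symm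
    isPiSystem_pi ?_
  rintro _ ⟨s, hs, rfl⟩
  simp only [Measure.pi_pi]
  refine Finset.measurable_prod _ fun i _ => ?_
  have hsi : MeasurableSet (s i) := hs i (Set.mem_univ i)
  exact (Measure.measurable_coe hsi).comp (comap_measurable _)

lemma measurable_pi_pi_probabilityMeasure (n m : ℕ) :
    Measurable fun Ps : Fin n → ProbabilityMeasure Y =>
      Measure.pi fun i : Fin n => Measure.pi fun _ : Fin m => (Ps i : Measure Y) := by
  refine Measurable.measure_of_isPiSystem_of_isProbabilityMeasure generateFrom_pi.symm
    isPiSystem_pi ?_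
  rintro _ ⟨s, hs, rfl⟩
  simp only [Measure.pi_pi]
  refine Finset.measurable_prod _ fun i _ => ?_
  have hsi : MeasurableSet (s i) := hs i (Set.mem_univ i)
  exact (Measure.measurable_coe hsi).comp
    ((measurable_pi_probabilityMeasure m).comp (measurable_pi_apply i))

/-- The law of one row of the two-stage sample. -/
def rowLaw (ν : Measure (ProbabilityMeasure Y)) (m : ℕ) : Measure (Fin m → Y) :=
  ν.bind fun P => Measure.pi fun _ : Fin m => (P : Measure Y)

instance isProbabilityMeasure_rowLaw (ν : Measure (ProbabilityMeasure Y)) [IsProbabilityMeasure ν]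
    (m : ℕ) : IsProbabilityMeasure (rowLaw ν m) := by
  constructor
  rw [rowLaw, Measure.bind_apply MeasurableSet.univ
    (measurable_pi_probabilityMeasure m).aemeasurable]
  simp

/-- The rows of the two-stage sample are i.i.d. -/
lemma twoStage_eq_pi (ν : Measure (ProbabilityMeasure Y)) [IsProbabilityMeasure ν] (n m : ℕ) :
    twoStage ν n m = Measure.pi fun _ : Fin n => rowLaw ν m := by
  refine (Measure.pi_eq fun s hs => ?_).symm
  have hmeas : ∀ i, Measurable fun P : ProbabilityMeasure Y =>
      (Measure.pi fun _ : Fin m => (P : Measure Y)) (s i) := fun i =>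
    (Measure.measurable_coe (hs i)).comp (measurable_pi_probabilityMeasure m)
  rw [twoStage, Measure.bind_apply (MeasurableSet.univ_pi hs)
    (measurable_pi_pi_probabilityMeasure n m).aemeasurable]
  simp only [Measure.pi_pi]
  have hind := iIndepFun_pi (μ := fun _ : Fin n => ν) fun i => (hmeas i).aemeasurable
  rw [lintegral_prod_eq_prod_lintegral_of_indepFun Finset.univ _ hind
    fun i => (hmeas i).comp (measurable_pi_apply i)]
  refine Finset.prod_congr rfl fun i _ => ?_
  rw [rowLaw, Measure.bind_apply (hs i) (measurable_pi_probabilityMeasure m).aemeasurable]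
  exact (measurePreserving_eval (fun _ : Fin n => ν) i).lintegral_comp (hmeas i)

end TwoStage

section UStatistic

lemma abs_covariance_le_of_abs_le {Ω : Type*} [MeasurableSpace Ω] {μ : Measure Ω}
    [IsProbabilityMeasure μ] {f g : Ω → ℝ} {B : ℝ} (hfm : Measurable f) (hgm : Measurable g)
    (hf : ∀ ω, |f ω| ≤ B) (hg : ∀ ω, |g ω| ≤ B) : |cov[f, g; μ]| ≤ 2 * B ^ 2 := by
  have hB : 0 ≤ B := by
    obtain ⟨ω⟩ := nonempty_of_isProbabilityMeasure μ
    exact (abs_nonneg _).trans (hf ω)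
  rw [covariance_eq_sub (.of_bound hfm.aestronglyMeasurable B (.of_forall hf))
    (.of_bound hgm.aestronglyMeasurable B (.of_forall hg))]
  have h1 : |∫ ω, f ω ∂μ| ≤ B := by
    simpa using norm_integral_le_of_norm_le_const (μ := μ) (f := f) (.of_forall hf)
  have h2 : |∫ ω, g ω ∂μ| ≤ B := by
    simpa using norm_integral_le_of_norm_le_const (μ := μ) (f := g) (.of_forall hg)
  have h3 : |∫ ω, (f * g) ω ∂μ| ≤ B * B := by
    have : ∀ ω, ‖(f * g) ω‖ ≤ B * B := fun ω => by
      rw [Pi.mul_apply, norm_mul]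
      exact mul_le_mul (hf ω) (hg ω) (norm_nonneg _) hB
    simpa using norm_integral_le_of_norm_le_const (μ := μ) (.of_forall this)
  calc _ ≤ |∫ ω, (f * g) ω ∂μ| + |(∫ ω, f ω ∂μ) * ∫ ω, g ω ∂μ| := abs_sub _ _
    _ ≤ B * B + B * B := by
      rw [abs_mul]
      exact add_le_add h3 (mul_le_mul h1 h2 (abs_nonneg _) hB)
    _ = _ := by ring

variable {Z : Type*} [MeasurableSpace Z]

/-- Variance bound for the unnormalised U-statistic of order two of a bounded function. -/
lemma variance_sum_offDiag_le (ρ : Measure Z) [IsProbabilityMeasure ρ] {h : Z → Z → ℝ}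
    (hm : Measurable fun p : Z × Z => h p.1 p.2) {B : ℝ} (hB : ∀ x y, |h x y| ≤ B) (n : ℕ) :
    Var[fun X : Fin n → Z => ∑ p ∈ Finset.univ.offDiag, h (X p.1) (X p.2);
      Measure.pi fun _ => ρ] ≤ (n * (n - 1)) * (4 * n) * (2 * B ^ 2) := by
  set μ : Measure (Fin n → Z) := Measure.pi fun _ => ρ
  have hmeas (p : Fin n × Fin n) : Measurable fun X : Fin n → Z => h (X p.1) (X p.2) :=
    hm.comp (f := fun X : Fin n → Z => (X p.1, X p.2))
      ((measurable_pi_apply p.1).prodMk (measurable_pi_apply p.2))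
  have hLp (p : Fin n × Fin n) : MemLp (fun X : Fin n → Z => h (X p.1) (X p.2)) 2 μ :=
    .of_bound (hmeas p).aestronglyMeasurable B (.of_forall fun X => hB _ _)
  rw [variance_fun_sum' fun p _ => hLp p]
  have hind : iIndepFun (fun i (X : Fin n → Z) => X i) μ :=
    iIndepFun_pi (X := fun _ => id) fun _ => aemeasurable_id
  have hcov (p q : Fin n × Fin n) :
      cov[fun X => h (X p.1) (X p.2), fun X => h (X q.1) (X q.2); μ] ≤
        ((if q.1 = p.1 then 1 else 0) + (if q.1 = p.2 then 1 else 0) +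
          (if q.2 = p.1 then 1 else 0) + (if q.2 = p.2 then 1 else 0)) * (2 * B ^ 2) := by
    by_cases hpq : q.1 ≠ p.1 ∧ q.1 ≠ p.2 ∧ q.2 ≠ p.1 ∧ q.2 ≠ p.2
    · obtain ⟨h1, h2, h3, h4⟩ := hpq
      have := (hind.indepFun_prodMk_prodMk measurable_pi_apply p.1 p.2 q.1 q.2
        h1.symm h3.symm h2.symm h4.symm).comp hm hm
      have h0 := this.covariance_eq_zero (hLp p) (hLp q)
      simp only [Function.comp_def] at h0
      rw [h0]
      positivity
    · have hle := (le_abs_self _).trans (abs_covariance_le_of_abs_le (μ := μ) (hmeas p) (hmeas q)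
        (fun X => hB _ _) fun X => hB _ _)
      refine hle.trans (le_mul_of_one_le_left (by positivity) ?_)
      split_ifs <;> first | exact absurd ⟨‹_›, ‹_›, ‹_›, ‹_›⟩ hpq | norm_num
  have hfst (a : Fin n) : ∑ q : Fin n × Fin n, (if q.1 = a then (1 : ℝ) else 0) = n := by
    rw [Fintype.sum_prod_type_right]
    simp
  have hsnd (a : Fin n) : ∑ q : Fin n × Fin n, (if q.2 = a then (1 : ℝ) else 0) = n := by
    rw [Fintype.sum_prod_type]
    simp
  have hcount (p : Fin n × Fin n) : ∑ q ∈ (Finset.univ : Finset (Fin n)).offDiag,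
      cov[fun X => h (X p.1) (X p.2), fun X => h (X q.1) (X q.2); μ] ≤
        (4 * n) * (2 * B ^ 2) := by
    calc _ ≤ ∑ q ∈ (Finset.univ : Finset (Fin n)).offDiag, _ :=
          Finset.sum_le_sum fun q _ => hcov p q
      _ ≤ ∑ q : Fin n × Fin n, _ :=
          Finset.sum_le_sum_of_subset_of_nonneg (Finset.subset_univ _) fun q _ _ => by positivity
      _ = _ := by
          rw [← Finset.sum_mul]
          simp only [Finset.sum_add_distrib, hfst, hsnd]
          ring
  refine (Finset.sum_le_sum fun p _ => hcount p).trans_eq ?_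
  rw [Finset.sum_const, Finset.offDiag_card, nsmul_eq_mul, Finset.card_univ, Fintype.card_fin,
    Nat.cast_sub (Nat.le_mul_self n)]
  push_cast
  ring

end UStatistic

section Estimator

variable {Y : Type*} (k : Y → Y → ℝ) {m : ℕ}

/-- The unbiased within-row estimator of `⟨P|k|P⟩`. -/
def withinRow (x : Fin m → Y) : ℝ :=
  (1 / ((m : ℝ) * ((m : ℝ) - 1))) * ∑ j, ∑ t ∈ Finset.univ.erase j, k (x j) (x t)

/-- The unbiased between-row estimator of `⟨P|k|Q⟩`. -/
def betweenRow (x y : Fin m → Y) : ℝ :=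
  (1 / (m : ℝ) ^ 2) * ∑ j, ∑ t, k (x j) (y t)

/-- The U-statistic kernel of the distributional variance estimator. -/
def varKernel (x y : Fin m → Y) : ℝ :=
  withinRow k x - betweenRow k x y

variable {k}

lemma abs_withinRow_le {K : ℝ} (hK : ∀ x y, |k x y| ≤ K) (hm : 2 ≤ m) (x : Fin m → Y) :
    |withinRow k x| ≤ K := by
  have hm' : (2 : ℝ) ≤ m := by exact_mod_cast hm
  have hpos : (0 : ℝ) < m * (m - 1) := by apply mul_pos <;> linarith
  have : |∑ j, ∑ t ∈ Finset.univ.erase j, k (x j) (x t)| ≤ m * (m - 1) * K := by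
    calc _ ≤ ∑ j, ∑ t ∈ Finset.univ.erase j, K :=
          (Finset.abs_sum_le_sum_abs _ _).trans <| Finset.sum_le_sum fun j _ =>
            (Finset.abs_sum_le_sum_abs _ _).trans <| Finset.sum_le_sum fun t _ => hK _ _
      _ = _ := by
          simp [Finset.card_erase_of_mem, Nat.cast_sub (show 1 ≤ m by omega), mul_assoc]
  rw [withinRow, abs_mul, abs_of_pos (by positivity), one_div, inv_mul_le_iff₀ hpos]
  exact this

lemma abs_betweenRow_le {K : ℝ} (hK : ∀ x y, |k x y| ≤ K) (hm : 2 ≤ m) (x y : Fin m → Y) :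
    |betweenRow k x y| ≤ K := by
  have hpos : (0 : ℝ) < m ^ 2 := by positivity
  have : |∑ j, ∑ t, k (x j) (y t)| ≤ m ^ 2 * K := by
    calc _ ≤ ∑ j : Fin m, ∑ t : Fin m, K :=
          (Finset.abs_sum_le_sum_abs _ _).trans <| Finset.sum_le_sum fun j _ =>
            (Finset.abs_sum_le_sum_abs _ _).trans <| Finset.sum_le_sum fun t _ => hK _ _
      _ = _ := by simp; ring
  rw [betweenRow, abs_mul, abs_of_pos (by positivity), one_div, inv_mul_le_iff₀ hpos]
  exact this

lemma abs_varKernel_le {K : ℝ} (hK : ∀ x y, |k x y| ≤ K) (hm : 2 ≤ m) (x y : Fin m → Y) :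
    |varKernel k x y| ≤ 2 * K :=
  (abs_sub _ _).trans (by linarith [abs_withinRow_le hK hm x, abs_betweenRow_le hK hm x y])

lemma measurable_varKernel [MeasurableSpace Y] (hk : Measurable fun p : Y × Y => k p.1 p.2) :
    Measurable fun p : (Fin m → Y) × (Fin m → Y) => varKernel k p.1 p.2 := by
  unfold varKernel withinRow betweenRow
  refine Measurable.sub (.const_mul ?_ _) (.const_mul ?_ _)
  · refine Finset.measurable_sum _ fun j _ => Finset.measurable_sum _ fun t _ => ?_
    exact hk.comp (g := fun p : Y × Y => k p.1 p.2)
      (f := fun p : (Fin m → Y) × (Fin m → Y) => (p.1 j, p.1 t)) (by fun_prop)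
  · refine Finset.measurable_sum _ fun j _ => Finset.measurable_sum _ fun t _ => ?_
    exact hk.comp (g := fun p : Y × Y => k p.1 p.2)
      (f := fun p : (Fin m → Y) × (Fin m → Y) => (p.1 j, p.2 t)) (by fun_prop)

/-- The distributional variance estimator is a U-statistic of order two in the rows. -/
lemma varEst_eq_sum_offDiag {n : ℕ} (hn : 2 ≤ n) (X : Fin n → Fin m → Y) :
    varEst k n m X = (1 / ((n : ℝ) * ((n : ℝ) - 1))) *
      ∑ p ∈ Finset.univ.offDiag, varKernel k (X p.1) (X p.2) := by
  have hn' : (2 : ℝ) ≤ n := by exact_mod_cast hn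
  have h0 : (n : ℝ) ≠ 0 := by linarith
  have h1 : (n : ℝ) - 1 ≠ 0 := by linarith
  have hoff (f : Fin n → Fin n → ℝ) : ∑ p ∈ Finset.univ.offDiag, f p.1 p.2 =
      ∑ i, ∑ s ∈ Finset.univ.erase i, f i s := by
    refine Finset.sum_finset_product' _ _ _ fun p => ?_
    simp [Finset.mem_offDiag, eq_comm]
  rw [hoff fun i s => varKernel k (X i) (X s)]
  simp only [varKernel, Finset.sum_sub_distrib, Finset.sum_const,
    Finset.card_erase_of_mem (Finset.mem_univ _), Finset.card_univ, Fintype.card_fin,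
    nsmul_eq_mul, Nat.cast_sub (show 1 ≤ n by omega), Nat.cast_one, withinRow, betweenRow,
    ← Finset.mul_sum, varEst, mul_sub]
  congr 1
  · field_simp
  · field_simp

end Estimator

/-- Convergence rate of the distributional variance estimator: if `|k| ≤ K` then there
is a constant `C ≥ 0` depending only on `K` such that for all `n, m ≥ 2` the variance
of the estimator under the two-stage sampling law is at most `(C/n)(1 + 1/m)`. -/
theorem varEst_variance_rate (K : ℝ) :
    ∃ C : ℝ, 0 ≤ C ∧
      ∀ (Y : Type*) [MeasurableSpace Y] (k : Y → Y → ℝ),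
        (Measurable fun p : Y × Y => k p.1 p.2) →
        (∀ x y, k x y = k y x) →
        (∀ (N : ℕ) (x : Fin N → Y) (a : Fin N → ℝ),
          0 ≤ ∑ i, ∑ j, a i * k (x i) (x j) * a j) →
        (∀ x y, |k x y| ≤ K) →
        ∀ (ν : Measure (ProbabilityMeasure Y)), IsProbabilityMeasure ν →
        ∀ n m : ℕ, 2 ≤ n → 2 ≤ m →
          (∫ X, (varEst k n m X) ^ 2 ∂(twoStage ν n m))
              - (∫ X, varEst k n m X ∂(twoStage ν n m)) ^ 2
            ≤ (C / (n : ℝ)) * (1 + 1 / (m : ℝ)) := by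
  refine ⟨32 * (2 * K ^ 2), by positivity, ?_⟩
  intro Y _ k hk _ _ hK ν _ n m hn hm
  have hn' : (2 : ℝ) ≤ n := by exact_mod_cast hn
  have hn0 : (0 : ℝ) < n := by linarith
  have hn1 : (0 : ℝ) < n - 1 := by linarith
  rw [twoStage_eq_pi]
  have hmeas : Measurable (varEst k n m) := by
    simp only [funext (varEst_eq_sum_offDiag (k := k) (m := m) hn)]
    refine .const_mul (Finset.measurable_sum _ fun p _ => ?_) _
    exact (measurable_varKernel hk).comp (f := fun X : Fin n → Fin m → Y => (X p.1, X p.2))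
      ((measurable_pi_apply p.1).prodMk (measurable_pi_apply p.2))
  have hbound (X : Fin n → Fin m → Y) : ‖varEst k n m X‖ ≤ 2 * K := by
    have hsum : |∑ p ∈ (Finset.univ : Finset (Fin n)).offDiag, varKernel k (X p.1) (X p.2)| ≤
        n * (n - 1) * (2 * K) := by
      refine (Finset.abs_sum_le_sum_abs _ _).trans <|
        (Finset.sum_le_sum fun p _ => abs_varKernel_le hK hm _ _).trans_eq ?_
      rw [Finset.sum_const, Finset.offDiag_card, nsmul_eq_mul, Finset.card_univ,
        Fintype.card_fin, Nat.cast_sub (Nat.le_mul_self n)]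
      push_cast
      ring
    rw [varEst_eq_sum_offDiag hn, Real.norm_eq_abs, abs_mul, abs_of_pos (by positivity), one_div,
      inv_mul_le_iff₀ (by positivity)]
    exact hsum
  have hLp : MemLp (varEst k n m) 2 (Measure.pi fun _ : Fin n => rowLaw ν m) :=
    .of_bound hmeas.aestronglyMeasurable _ (.of_forall hbound)
  have hvar := variance_eq_sub hLp
  simp only [Pi.pow_apply] at hvar
  rw [← hvar, funext (varEst_eq_sum_offDiag (k := k) (m := m) hn), variance_const_mul]
  have hU := variance_sum_offDiag_le (rowLaw ν m) (measurable_varKernel hk)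
    (abs_varKernel_le hK hm) n
  calc _ ≤ (1 / ((n : ℝ) * (n - 1))) ^ 2 * (n * (n - 1) * (4 * n) * (2 * (2 * K) ^ 2)) := by
        gcongr
    _ = 16 * (2 * K ^ 2) / (n - 1) := by
        field_simp
        ring
    _ ≤ 32 * (2 * K ^ 2) / n := by
        rw [div_le_div_iff₀ hn1 hn0]
        nlinarith [sq_nonneg K]
    _ ≤ _ := le_mul_of_one_le_right (by positivity) (le_add_of_nonneg_right (by positivity))
end
end

section
/- Fix m ≥ 2. Then the distributional covariance estimator is weakly consistent in the number of outer samples: for every ε > 0, μ_{n,m}({(X, Y) : |Ĉov_k^{(n,m)}(X, Y) − Cov_k(ν)| ≥ ε}) → 0 as n → ∞, where Cov_k(ν) := ∫ ⟨P|k|Q⟩ dν(P, Q) − ⟨join(ν₁)|k|join(ν₂)⟩. -/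
open MeasureTheory ProbabilityTheory

noncomputable section

/-- `join(ν)`: the probability measure `A ↦ ∫ P(A) dν(P)`. -/
def pmJoin {Y : Type*} [MeasurableSpace Y] (ν : Measure (ProbabilityMeasure Y)) : Measure Y :=
  ν.bind (fun P => (P : Measure Y))

/-- The two-stage pair-sampling law `μ_{n,m}` on `Fin n → (Fin m → Y) × (Fin m → Y)`:
sample pairs `(P₁, Q₁), …, (Pₙ, Qₙ)` i.i.d. from `ν`, then conditionally on `(Pᵢ, Qᵢ)`
sample `X_{i1}, …, X_{im}` i.i.d. from `Pᵢ` and `Y_{i1}, …, Y_{im}` i.i.d. from `Qᵢ`,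
conditionally independently, and independently across `i`. -/
def pairTwoStage {Y : Type*} [MeasurableSpace Y]
    (ν : Measure (ProbabilityMeasure Y × ProbabilityMeasure Y)) (n m : ℕ) :
    Measure (Fin n → (Fin m → Y) × (Fin m → Y)) :=
  (Measure.pi fun _ : Fin n => ν).bind
    (fun PQ => Measure.pi fun i : Fin n =>
      (Measure.pi fun _ : Fin m => ((PQ i).1 : Measure Y)).prod
        (Measure.pi fun _ : Fin m => ((PQ i).2 : Measure Y)))

/-- The distributional covariance estimator
`Ĉov_k^{(n,m)}(X, Y) = (1/(n m²)) Σᵢ Σ_{j,t} k(X_{ij}, Y_{it})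
  − (1/(n (n−1) m²)) Σ_{i≠s} Σ_{j,t} k(X_{ij}, Y_{st})`. -/
def covEst {Y : Type*} (k : Y → Y → ℝ) (n m : ℕ) (X Y' : Fin n → Fin m → Y) : ℝ :=
  (1 / ((n : ℝ) * (m : ℝ) ^ 2)) * ∑ i, ∑ j, ∑ t, k (X i j) (Y' i t)
  - (1 / ((n : ℝ) * ((n : ℝ) - 1) * (m : ℝ) ^ 2)) *
      ∑ i, ∑ s ∈ Finset.univ.erase i, ∑ j, ∑ t, k (X i j) (Y' s t)

open Finset in
/-- Mean-square bound for a bounded centred U-statistic of order two. -/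
theorem integral_sq_sum_offDiag_le {S : Type*} [MeasurableSpace S] (l : Measure S)
    [IsProbabilityMeasure l] {g : S × S → ℝ} (hg : Measurable g) {K : ℝ}
    (hK : ∀ p, |g p| ≤ K) (h0 : ∫ p, g p ∂(l.prod l) = 0) (n : ℕ) :
    ∫ z, (∑ i, ∑ s ∈ univ.erase i, g (z i, z s)) ^ 2 ∂(Measure.pi fun _ : Fin n => l)
      ≤ 4 * K ^ 2 * n ^ 3 := by
  set μ := Measure.pi fun _ : Fin n => l
  let G : Fin n → Fin n → (Fin n → S) → ℝ := fun i s z => if i = s then 0 else g (z i, z s)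
  obtain ⟨⟨p₀⟩⟩ : Nonempty (Nonempty S) := ⟨l.nonempty_of_neZero⟩
  have hK0 : 0 ≤ K := (abs_nonneg _).trans (hK (p₀, p₀))
  have hGm : ∀ i s, Measurable (G i s) := by
    intro i s
    by_cases h : i = s
    · simp [G, h]
    · simp only [G, h, if_false]; fun_prop
  have hGb : ∀ i s z, |G i s z| ≤ K := by
    intro i s z
    by_cases h : i = s
    · simp [G, h, hK0]
    · simp only [G, h, if_false]; exact hK _
  have hGGb : ∀ i s i' s' z, |G i s z * G i' s' z| ≤ K ^ 2 := by
    intro i s i' s' z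
    rw [abs_mul, sq]
    exact mul_le_mul (hGb _ _ _) (hGb _ _ _) (abs_nonneg _) hK0
  have hGGi : ∀ i s i' s', Integrable (fun z => G i s z * G i' s' z) μ := fun i s i' s' =>
    .of_bound ((hGm i s).mul (hGm i' s')).aestronglyMeasurable (K ^ 2)
      (ae_of_all _ fun z => hGGb i s i' s' z)
  have hind : iIndepFun (fun (i : Fin n) (z : Fin n → S) => z i) μ :=
    iIndepFun_pi (X := fun _ x => x) fun _ => aemeasurable_id
  have hzero : ∀ i s, ∫ z, G i s z ∂μ = 0 := by
    intro i s
    by_cases h : i = s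
    · simp [G, h]
    · simp only [G, h, if_false]
      have hmap : μ.map (fun z => (z i, z s)) = l.prod l := by
        rw [(hind.indepFun h).map_prod_eq_prod_map_map
            (measurable_pi_apply i).aemeasurable (measurable_pi_apply s).aemeasurable,
          (measurePreserving_eval _ i).map_eq, (measurePreserving_eval _ s).map_eq]
      rw [← h0, ← hmap, integral_map (by fun_prop) hg.aestronglyMeasurable]
  have hprod : ∀ i s i' s', ∫ z, G i s z * G i' s' z ∂μ
      ≤ K ^ 2 * ((if i = i' then 1 else 0) + (if i = s' then 1 else 0)
        + (if s = i' then 1 else 0) + (if s = s' then 1 else 0)) := by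
    intro i s i' s'
    by_cases hd : i ≠ i' ∧ i ≠ s' ∧ s ≠ i' ∧ s ≠ s'
    · obtain ⟨h1, h2, h3, h4⟩ := hd
      have hG : ∀ i s, ∃ φ : S × S → ℝ, Measurable φ ∧ G i s = φ ∘ fun z => (z i, z s) := by
        intro i s
        by_cases h : i = s
        · exact ⟨fun _ => 0, measurable_const, by ext; simp [G, h]⟩
        · exact ⟨g, hg, by ext; simp [G, h]⟩
      obtain ⟨φ, hφ, e⟩ := hG i s
      obtain ⟨ψ, hψ, e'⟩ := hG i' s'
      have hi : IndepFun (G i s) (G i' s') μ := by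
        rw [e, e']
        exact (hind.indepFun_prodMk_prodMk (fun _ => by fun_prop) i s i' s' h1 h2 h3 h4).comp hφ hψ
      have := hi.integral_mul_eq_mul_integral (hGm i s).aestronglyMeasurable
        (hGm i' s').aestronglyMeasurable
      simp only [Pi.mul_apply] at this
      rw [this, hzero, zero_mul]
      simp [h1, h2, h3, h4]
    · have h1 : ∫ z, G i s z * G i' s' z ∂μ ≤ K ^ 2 := by
        have := integral_mono (hGGi i s i' s') (integrable_const (K ^ 2))
          fun z => (abs_le.1 (hGGb i s i' s' z)).2
        simpa using this
      refine h1.trans (le_mul_of_one_le_right (sq_nonneg K) ?_)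
      split_ifs <;> first | (exfalso; tauto) | norm_num
  have hexp : ∀ z : Fin n → S, (∑ i, ∑ s ∈ univ.erase i, g (z i, z s)) ^ 2
      = ∑ i, ∑ s, ∑ i', ∑ s', G i s z * G i' s' z := by
    intro z
    have : ∑ i, ∑ s ∈ univ.erase i, g (z i, z s) = ∑ i, ∑ s, G i s z := by
      refine sum_congr rfl fun i _ => ?_
      rw [← sum_erase_add _ _ (mem_univ i)]
      simp only [G, if_true, add_zero]
      exact sum_congr rfl fun s hs => by rw [if_neg (ne_of_mem_erase hs).symm]
    rw [this, sq, sum_mul]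
    simp_rw [sum_mul, mul_sum]
  simp only [hexp]
  have hint1 := fun i s i' => integrable_finsetSum univ fun s' _ => hGGi i s i' s'
  have hint2 := fun i s => integrable_finsetSum univ fun i' _ => hint1 i s i'
  have hint3 := fun i => integrable_finsetSum univ fun s _ => hint2 i s
  rw [integral_finsetSum _ fun i _ => hint3 i]
  simp_rw [integral_finsetSum _ fun s _ => hint2 _ s, integral_finsetSum _ fun i' _ => hint1 _ _ i',
    integral_finsetSum _ fun s' _ => hGGi _ _ _ s']
  calc _ ≤ ∑ i, ∑ s, ∑ i', ∑ s', K ^ 2 * ((if i = i' then (1 : ℝ) else 0)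
        + (if i = s' then 1 else 0) + (if s = i' then 1 else 0) + (if s = s' then 1 else 0)) :=
        sum_le_sum fun i _ => sum_le_sum fun s _ => sum_le_sum fun i' _ => sum_le_sum fun s' _ =>
          hprod i s i' s'
    _ = 4 * K ^ 2 * n ^ 3 := by
        simp only [mul_add, sum_add_distrib, ← mul_sum]
        simp
        ring

/-- Weak law of large numbers for bounded centred U-statistics of order two. -/
theorem tendsto_measure_uStatistic {S : Type*} [MeasurableSpace S] (l : Measure S)
    [IsProbabilityMeasure l] {g : S × S → ℝ} (hg : Measurable g) {K : ℝ}
    (hK : ∀ p, |g p| ≤ K) (h0 : ∫ p, g p ∂(l.prod l) = 0) {ε : ℝ} (hε : 0 < ε) :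
    Filter.Tendsto (fun n : ℕ => (Measure.pi fun _ : Fin n => l)
      {z | ε ≤ |1 / ((n : ℝ) * ((n : ℝ) - 1)) *
        ∑ i, ∑ s ∈ Finset.univ.erase i, g (z i, z s)|}) Filter.atTop (nhds 0) := by
  have hlim : Filter.Tendsto (fun n : ℕ => 16 * K ^ 2 / ε ^ 2 * ((n : ℝ))⁻¹)
      Filter.atTop (nhds 0) := by
    simpa using (tendsto_inv_atTop_nhds_zero_nat (𝕜 := ℝ)).const_mul (16 * K ^ 2 / ε ^ 2)
  have hlim' := ENNReal.tendsto_ofReal hlim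
  rw [ENNReal.ofReal_zero] at hlim'
  refine tendsto_of_tendsto_of_tendsto_of_le_of_le' tendsto_const_nhds hlim'
    (Filter.Eventually.of_forall fun _ => zero_le) ?_
  filter_upwards [Filter.eventually_ge_atTop 2] with n hn
  have hn' : (2 : ℝ) ≤ n := by exact_mod_cast hn
  set μ := Measure.pi fun _ : Fin n => l
  set U : (Fin n → S) → ℝ := fun z => ∑ i, ∑ s ∈ Finset.univ.erase i, g (z i, z s)
  have hUm : Measurable U := by fun_prop
  set c : ℝ := 1 / ((n : ℝ) * ((n : ℝ) - 1))
  have hUb : ∀ z, |U z| ≤ n * (n * K) := by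
    intro z
    have hK0 : 0 ≤ K := (abs_nonneg _).trans (hK (z ⟨0, by omega⟩, z ⟨0, by omega⟩))
    refine (Finset.abs_sum_le_sum_abs _ _).trans ?_
    refine (Finset.sum_le_card_nsmul _ _ (n * K) fun i _ => ?_).trans (by simp)
    refine (Finset.abs_sum_le_sum_abs _ _).trans ?_
    refine (Finset.sum_le_sum_of_subset_of_nonneg (Finset.erase_subset _ _)
      fun _ _ _ => abs_nonneg _).trans ?_
    exact (Finset.sum_le_card_nsmul _ _ K fun i _ => hK _).trans (by simp)
  have hUi : Integrable (fun z => (c * U z) ^ 2) μ := by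
    refine .of_bound (by fun_prop) ((|c| * (n * (n * K))) ^ 2) (ae_of_all _ fun z => ?_)
    rw [Real.norm_eq_abs, abs_pow, abs_mul]
    have := hUb z
    gcongr
  have hmk := mul_meas_ge_le_integral_of_nonneg (μ := μ)
    (ae_of_all _ fun z => sq_nonneg (c * U z)) hUi (ε ^ 2)
  have hset : {z | ε ≤ |c * U z|} = {z | ε ^ 2 ≤ (c * U z) ^ 2} := by
    ext z
    simp only [Set.mem_ofPred_eq, sq_le_sq, abs_of_pos hε]
  have hsq : ∫ z, (c * U z) ^ 2 ∂μ ≤ 16 * K ^ 2 * ((n : ℝ))⁻¹ := by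
    simp_rw [mul_pow]
    rw [integral_const_mul]
    refine (mul_le_mul_of_nonneg_left (integral_sq_sum_offDiag_le l hg hK h0 n)
      (sq_nonneg c)).trans ?_
    have hc : c ≤ 2 / (n : ℝ) ^ 2 := by
      rw [div_le_div_iff₀ (by nlinarith) (by positivity)]
      nlinarith
    have hc0 : 0 ≤ c := div_nonneg zero_le_one (by nlinarith)
    calc c ^ 2 * (4 * K ^ 2 * n ^ 3) ≤ (2 / (n : ℝ) ^ 2) ^ 2 * (4 * K ^ 2 * n ^ 3) := by gcongr
      _ = 16 * K ^ 2 * ((n : ℝ))⁻¹ := by field_simp; ring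
  change μ {z | ε ≤ |c * U z|} ≤ _
  rw [hset]
  refine ENNReal.le_ofReal_iff_toReal_le (measure_ne_top _ _) (by positivity) |>.2 ?_
  change μ.real _ ≤ _
  rw [div_mul_eq_mul_div, le_div_iff₀ (by positivity), mul_comm]
  exact hmk.trans hsq

/-- Sampling the components independently through a kernel commutes with finite powers. -/
theorem pi_bind_pi {ι A B : Type*} [Fintype ι] [MeasurableSpace A] [MeasurableSpace B]
    (ν : Measure A) [IsProbabilityMeasure ν] (κ : Kernel A B) [IsMarkovKernel κ] :
    (Measure.pi fun _ : ι => ν).bind (fun a => Measure.pi fun i => κ (a i))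
      = Measure.pi fun _ : ι => ν.bind κ := by
  have hmeas : Measurable fun a : ι → A => Measure.pi fun i => κ (a i) := by
    refine .measure_of_isPiSystem_of_isProbabilityMeasure generateFrom_pi.symm isPiSystem_pi ?_
    rintro _ ⟨s, hs, rfl⟩
    simp only [Measure.pi_pi]
    refine Finset.measurable_prod _ fun i _ => ?_
    exact (κ.measurable_coe (hs i trivial)).comp (measurable_pi_apply i)
  symm
  refine Measure.pi_eq fun s hs => ?_
  rw [Measure.bind_apply (.univ_pi hs) hmeas.aemeasurable]
  simp only [Measure.pi_pi]
  refine (lintegral_prod_eq_prod_lintegral_of_indepFun Finset.univ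
    (fun i (a : ι → A) => κ (a i) (s i))
    (iIndepFun_pi (X := fun i x => κ x (s i)) fun i => (κ.measurable_coe (hs i)).aemeasurable)
    fun i => (κ.measurable_coe (hs i)).comp (measurable_pi_apply i)).trans ?_
  refine Finset.prod_congr rfl fun i _ => ?_
  rw [Measure.bind_apply (hs i) κ.aemeasurable,
    ← (measurePreserving_eval (fun _ : ι => ν) i).lintegral_comp (κ.measurable_coe (hs i))]

theorem measurable_probabilityMeasure_coe {Y : Type*} [MeasurableSpace Y] :
    Measurable fun P : ProbabilityMeasure Y => (P : Measure Y) :=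
  measurable_iff_comap_le.2 le_rfl

/-- The kernel `P ↦ P^{⊗ m}`. -/
def iidKernel (Y : Type*) [MeasurableSpace Y] (m : ℕ) :
    Kernel (ProbabilityMeasure Y) (Fin m → Y) where
  toFun P := Measure.pi fun _ => (P : Measure Y)
  measurable' := by
    refine .measure_of_isPiSystem_of_isProbabilityMeasure generateFrom_pi.symm isPiSystem_pi ?_
    rintro _ ⟨s, hs, rfl⟩
    simp only [Measure.pi_pi]
    exact Finset.measurable_prod _ fun i _ =>
      (Measure.measurable_coe (hs i trivial)).comp measurable_probabilityMeasure_coe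

theorem iidKernel_apply {Y : Type*} [MeasurableSpace Y] (m : ℕ) (P : ProbabilityMeasure Y) :
    iidKernel Y m P = Measure.pi fun _ => (P : Measure Y) := rfl

instance {Y : Type*} [MeasurableSpace Y] (m : ℕ) : IsMarkovKernel (iidKernel Y m) :=
  ⟨fun P => by rw [iidKernel_apply]; infer_instance⟩

/-- The kernel `(P, Q) ↦ P^{⊗ m} ⊗ Q^{⊗ m}`. -/
def pairKernel (Y : Type*) [MeasurableSpace Y] (m : ℕ) :
    Kernel (ProbabilityMeasure Y × ProbabilityMeasure Y) ((Fin m → Y) × (Fin m → Y)) :=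
  ((iidKernel Y m).comap Prod.fst measurable_fst).prod
    ((iidKernel Y m).comap Prod.snd measurable_snd)

instance {Y : Type*} [MeasurableSpace Y] (m : ℕ) : IsMarkovKernel (pairKernel Y m) := by
  unfold pairKernel; infer_instance

theorem pairKernel_apply {Y : Type*} [MeasurableSpace Y] (m : ℕ)
    (PQ : ProbabilityMeasure Y × ProbabilityMeasure Y) :
    pairKernel Y m PQ = (Measure.pi fun _ : Fin m => (PQ.1 : Measure Y)).prod
      (Measure.pi fun _ : Fin m => (PQ.2 : Measure Y)) := by
  rw [pairKernel, Kernel.prod_apply, Kernel.comap_apply, Kernel.comap_apply, iidKernel_apply,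
    iidKernel_apply]

theorem pairTwoStage_eq_pi {Y : Type*} [MeasurableSpace Y]
    (ν : Measure (ProbabilityMeasure Y × ProbabilityMeasure Y)) [IsProbabilityMeasure ν]
    (n m : ℕ) :
    pairTwoStage ν n m = Measure.pi fun _ : Fin n => ν.bind (pairKernel Y m) := by
  rw [← pi_bind_pi, pairTwoStage]
  simp only [pairKernel_apply]

/-- The first marginal of each inner sample is the join of the first marginal of `ν`. -/
theorem bind_pairKernel_map_fst {Y : Type*} [MeasurableSpace Y]
    (ν : Measure (ProbabilityMeasure Y × ProbabilityMeasure Y)) {m : ℕ} (j : Fin m) :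
    (ν.bind (pairKernel Y m)).map (fun z => z.1 j) = pmJoin (ν.map Prod.fst) := by
  ext s hs
  have hf : Measurable fun z : (Fin m → Y) × (Fin m → Y) => z.1 j := by fun_prop
  rw [Measure.map_apply hf hs, Measure.bind_apply (hf hs) (pairKernel Y m).aemeasurable, pmJoin,
    Measure.bind_apply hs measurable_probabilityMeasure_coe.aemeasurable,
    lintegral_map (f := fun P : ProbabilityMeasure Y => (P : Measure Y) s)
      ((Measure.measurable_coe hs).comp measurable_probabilityMeasure_coe) measurable_fst]
  refine lintegral_congr fun PQ => ?_
  have hpre : (fun z : (Fin m → Y) × (Fin m → Y) => z.1 j) ⁻¹' s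
      = (Function.eval j ⁻¹' s) ×ˢ Set.univ := by
    ext; simp
  rw [pairKernel_apply, hpre, Measure.prod_prod, measure_univ, mul_one,
    (measurePreserving_eval _ j).measure_preimage hs.nullMeasurableSet]

/-- The second marginal of each inner sample is the join of the second marginal of `ν`. -/
theorem bind_pairKernel_map_snd {Y : Type*} [MeasurableSpace Y]
    (ν : Measure (ProbabilityMeasure Y × ProbabilityMeasure Y)) {m : ℕ} (j : Fin m) :
    (ν.bind (pairKernel Y m)).map (fun z => z.2 j) = pmJoin (ν.map Prod.snd) := by
  ext s hs
  have hf : Measurable fun z : (Fin m → Y) × (Fin m → Y) => z.2 j := by fun_prop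
  rw [Measure.map_apply hf hs, Measure.bind_apply (hf hs) (pairKernel Y m).aemeasurable, pmJoin,
    Measure.bind_apply hs measurable_probabilityMeasure_coe.aemeasurable,
    lintegral_map (f := fun P : ProbabilityMeasure Y => (P : Measure Y) s)
      ((Measure.measurable_coe hs).comp measurable_probabilityMeasure_coe) measurable_snd]
  refine lintegral_congr fun PQ => ?_
  have hpre : (fun z : (Fin m → Y) × (Fin m → Y) => z.2 j) ⁻¹' s
      = Set.univ ×ˢ (Function.eval j ⁻¹' s) := by
    ext; simp
  rw [pairKernel_apply, hpre, Measure.prod_prod, measure_univ, one_mul,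
    (measurePreserving_eval _ j).measure_preimage hs.nullMeasurableSet]

/-- The block average `(1/m²) Σ_{j,t} k(X_j, Y_t)`. -/
def blockMean {Y : Type*} (k : Y → Y → ℝ) (m : ℕ) (X Y' : Fin m → Y) : ℝ :=
  1 / (m : ℝ) ^ 2 * ∑ j, ∑ t, k (X j) (Y' t)

theorem abs_blockMean_le {Y : Type*} {k : Y → Y → ℝ} {K : ℝ} (hK : ∀ x y, |k x y| ≤ K)
    {m : ℕ} (hm : m ≠ 0) (X Y' : Fin m → Y) : |blockMean k m X Y'| ≤ K := by
  have hm' : (m : ℝ) ≠ 0 := Nat.cast_ne_zero.2 hm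
  have : |∑ j, ∑ t, k (X j) (Y' t)| ≤ m * (m * K) := by
    refine (Finset.abs_sum_le_sum_abs _ _).trans ?_
    refine (Finset.sum_le_card_nsmul _ _ (m * K) fun i _ => ?_).trans (by simp)
    refine (Finset.abs_sum_le_sum_abs _ _).trans ?_
    exact (Finset.sum_le_card_nsmul _ _ K fun i _ => hK _ _).trans (by simp)
  rw [blockMean, abs_mul, abs_of_nonneg (by positivity)]
  calc _ ≤ 1 / (m : ℝ) ^ 2 * (m * (m * K)) := by gcongr
    _ = K := by field_simp

/-- Averaging over blocks whose coordinates have laws `P` and `Q` gives `⟨P|k|Q⟩`. -/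
theorem integral_blockMean {Y Ω : Type*} [MeasurableSpace Y] [MeasurableSpace Ω]
    {k : Y → Y → ℝ} (hk : Measurable fun p : Y × Y => k p.1 p.2) {K : ℝ}
    (hK : ∀ x y, |k x y| ≤ K) {m : ℕ} (hm : m ≠ 0) (μ : Measure Ω) [IsProbabilityMeasure μ]
    (P Q : Measure Y) [IsProbabilityMeasure P] [IsProbabilityMeasure Q]
    {X Y' : Ω → Fin m → Y} (hX : Measurable X) (hY : Measurable Y')
    (hlaw : ∀ j t, μ.map (fun w => (X w j, Y' w t)) = P.prod Q) :
    ∫ w, blockMean k m (X w) (Y' w) ∂μ = kerInner k P Q := by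
  have hm' : (m : ℝ) ≠ 0 := Nat.cast_ne_zero.2 hm
  have hXY : ∀ j t, Measurable fun w => (X w j, Y' w t) := fun j t => by fun_prop
  have hint : ∀ j t, Integrable (fun w => k (X w j) (Y' w t)) μ := fun j t =>
    .of_bound (hk.comp (hXY j t)).aestronglyMeasurable K (ae_of_all _ fun w => hK _ _)
  have hval : ∀ j t, ∫ w, k (X w j) (Y' w t) ∂μ = kerInner k P Q := by
    intro j t
    rw [← integral_map (hXY j t).aemeasurable (f := fun p : Y × Y => k p.1 p.2)
      hk.aestronglyMeasurable, hlaw, integral_prod _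
      (.of_bound hk.aestronglyMeasurable K (ae_of_all _ fun w => hK _ _)), kerInner]
  simp only [blockMean]
  rw [integral_const_mul,
    integral_finsetSum _ fun j _ => integrable_finsetSum _ fun t _ => hint j t]
  simp_rw [integral_finsetSum _ fun t _ => hint _ t, hval]
  simp
  field_simp

theorem measurable_blockMean {Y Ω : Type*} [MeasurableSpace Y] [MeasurableSpace Ω]
    {k : Y → Y → ℝ} (hk : Measurable fun p : Y × Y => k p.1 p.2) {m : ℕ}
    {X Y' : Ω → Fin m → Y} (hX : Measurable X) (hY : Measurable Y') :
    Measurable fun w => blockMean k m (X w) (Y' w) := by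
  unfold blockMean
  refine .const_mul (Finset.measurable_sum _ fun j _ => Finset.measurable_sum _ fun t _ => ?_) _
  exact hk.comp (f := fun w => (X w j, Y' w t)) (by fun_prop)

/-- The covariance estimator, centred at `C`, as a U-statistic of order two. -/
theorem covEst_sub_eq_uStatistic {Y : Type*} (k : Y → Y → ℝ) {n : ℕ} (hn : 2 ≤ n) (m : ℕ)
    (X Y' : Fin n → Fin m → Y) (C : ℝ) :
    covEst k n m X Y' - C = 1 / ((n : ℝ) * ((n : ℝ) - 1)) *
      ∑ i, ∑ s ∈ Finset.univ.erase i,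
        (blockMean k m (X i) (Y' i) - blockMean k m (X i) (Y' s) - C) := by
  have hn' : (2 : ℝ) ≤ n := by exact_mod_cast hn
  have h0 : (n : ℝ) ≠ 0 := by linarith
  have h1 : (n : ℝ) - 1 ≠ 0 := by linarith
  have hcard : ((n - 1 : ℕ) : ℝ) = n - 1 := by push_cast [show 1 ≤ n by omega]; rfl
  simp only [covEst, blockMean, Finset.sum_sub_distrib, Finset.sum_const, ← Finset.mul_sum,
    Finset.card_erase_of_mem (Finset.mem_univ _), Finset.card_univ, Fintype.card_fin, nsmul_eq_mul,
    hcard]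
  field_simp

/-- Weak consistency of the distributional covariance estimator in the number of outer
samples: for fixed `m ≥ 2` and every `ε > 0`,
`μ_{n,m}(|Ĉov_k^{(n,m)} − Cov_k(ν)| ≥ ε) → 0` as `n → ∞`. -/
theorem covEst_weakly_consistent
    {Y : Type*} [MeasurableSpace Y]
    (k : Y → Y → ℝ)
    (hk_meas : Measurable fun p : Y × Y => k p.1 p.2)
    (hk_symm : ∀ x y, k x y = k y x)
    (hk_bdd : ∃ K, ∀ x y, |k x y| ≤ K)
    (hk_psd : ∀ (N : ℕ) (x : Fin N → Y) (a : Fin N → ℝ),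
      0 ≤ ∑ i, ∑ j, a i * k (x i) (x j) * a j)
    (ν : Measure (ProbabilityMeasure Y × ProbabilityMeasure Y)) [IsProbabilityMeasure ν]
    (m : ℕ) (hm : 2 ≤ m) :
    ∀ ε : ℝ, 0 < ε →
      Filter.Tendsto
        (fun n : ℕ =>
          pairTwoStage ν n m
            {Z | ε ≤ |covEst k n m (fun i => (Z i).1) (fun i => (Z i).2)
              - ((∫ PQ, kerInner k (PQ.1 : Measure Y) (PQ.2 : Measure Y) ∂ν)
                  - kerInner k (pmJoin (ν.map Prod.fst)) (pmJoin (ν.map Prod.snd)))|})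
        Filter.atTop (nhds 0) := by
  intro ε hε
  obtain ⟨K, hK⟩ := hk_bdd
  have hm0 : m ≠ 0 := by omega
  set C := (∫ PQ, kerInner k (PQ.1 : Measure Y) (PQ.2 : Measure Y) ∂ν)
    - kerInner k (pmJoin (ν.map Prod.fst)) (pmJoin (ν.map Prod.snd)) with hC
  set l := ν.bind (pairKernel Y m) with hl
  have : IsProbabilityMeasure l := by
    rw [hl]; infer_instance
  have hj1 : IsProbabilityMeasure (pmJoin (ν.map Prod.fst)) := by
    rw [← bind_pairKernel_map_fst ν (⟨0, by omega⟩ : Fin m)]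
    exact Measure.isProbabilityMeasure_map (by fun_prop)
  have hj2 : IsProbabilityMeasure (pmJoin (ν.map Prod.snd)) := by
    rw [← bind_pairKernel_map_snd ν (⟨0, by omega⟩ : Fin m)]
    exact Measure.isProbabilityMeasure_map (by fun_prop)
  have hdiag_meas := measurable_blockMean hk_meas (m := m)
    (X := fun z : (Fin m → Y) × (Fin m → Y) => z.1) measurable_fst measurable_snd
  have hdiag : ∫ z, blockMean k m z.1 z.2 ∂l
      = ∫ PQ, kerInner k (PQ.1 : Measure Y) (PQ.2 : Measure Y) ∂ν := by
    have hi : Integrable (fun z : (Fin m → Y) × (Fin m → Y) => blockMean k m z.1 z.2)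
        ((pairKernel Y m ∘ₖ Kernel.const Unit ν) ()) :=
      .of_bound hdiag_meas.aestronglyMeasurable K (ae_of_all _ fun z => abs_blockMean_le hK hm0 _ _)
    have := Kernel.integral_comp hi
    rw [Kernel.comp_apply, Kernel.const_apply] at this
    rw [hl, this]
    refine integral_congr_ae (ae_of_all _ fun PQ => ?_)
    refine integral_blockMean hk_meas hK hm0 _ _ _ measurable_fst measurable_snd fun j t => ?_
    rw [pairKernel_apply]
    have := Measure.map_prod_map (Measure.pi fun _ : Fin m => (PQ.1 : Measure Y))
      (Measure.pi fun _ : Fin m => (PQ.2 : Measure Y)) (measurable_pi_apply j)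
      (measurable_pi_apply t)
    rw [(measurePreserving_eval _ j).map_eq, (measurePreserving_eval _ t).map_eq] at this
    exact this.symm
  have hcross : ∫ p : _ × _, blockMean k m p.1.1 p.2.2 ∂(l.prod l)
      = kerInner k (pmJoin (ν.map Prod.fst)) (pmJoin (ν.map Prod.snd)) := by
    refine integral_blockMean hk_meas hK hm0 _ _ _ (by fun_prop) (by fun_prop) fun j t => ?_
    rw [← bind_pairKernel_map_fst ν j, ← bind_pairKernel_map_snd ν t,
      Measure.map_prod_map _ _ (by fun_prop) (by fun_prop)]
    rfl
  set g : ((Fin m → Y) × (Fin m → Y)) × ((Fin m → Y) × (Fin m → Y)) → ℝ := fun p =>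
    blockMean k m p.1.1 p.1.2 - blockMean k m p.1.1 p.2.2 - C
  have hm1 : Measurable fun p : ((Fin m → Y) × (Fin m → Y)) × ((Fin m → Y) × (Fin m → Y)) =>
      blockMean k m p.1.1 p.1.2 := measurable_blockMean hk_meas (by fun_prop) (by fun_prop)
  have hm2 : Measurable fun p : ((Fin m → Y) × (Fin m → Y)) × ((Fin m → Y) × (Fin m → Y)) =>
      blockMean k m p.1.1 p.2.2 := measurable_blockMean hk_meas (by fun_prop) (by fun_prop)
  have hg : Measurable g := (hm1.sub hm2).sub_const C
  have hgK : ∀ p, |g p| ≤ K + K + |C| := fun p =>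
    (abs_sub _ _).trans (add_le_add ((abs_sub _ _).trans
      (add_le_add (abs_blockMean_le hK hm0 _ _) (abs_blockMean_le hK hm0 _ _))) le_rfl)
  have hi1 : Integrable (fun p : _ × _ => blockMean k m p.1.1 p.1.2) (l.prod l) :=
    .of_bound hm1.aestronglyMeasurable K (ae_of_all _ fun z => abs_blockMean_le hK hm0 _ _)
  have hi2 : Integrable (fun p : _ × _ => blockMean k m p.1.1 p.2.2) (l.prod l) :=
    .of_bound hm2.aestronglyMeasurable K (ae_of_all _ fun z => abs_blockMean_le hK hm0 _ _)
  have hg0 : ∫ p, g p ∂(l.prod l) = 0 := by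
    have hfst := integral_fun_fst (μ := l) (ν := l)
      fun z : (Fin m → Y) × (Fin m → Y) => blockMean k m z.1 z.2
    have hsub := integral_sub (hi1.sub hi2) (integrable_const C)
    simp only [Pi.sub_apply] at hsub
    rw [show ∫ p, g p ∂(l.prod l) = _ from hsub, integral_sub hi1 hi2, hcross, hfst, hdiag]
    simp [hC]
  refine (tendsto_measure_uStatistic l hg hgK hg0 hε).congr' ?_
  filter_upwards [Filter.eventually_ge_atTop 2] with n hn
  rw [pairTwoStage_eq_pi]
  simp only [covEst_sub_eq_uStatistic k hn]
  rfl
end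
end
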